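/- arXiv:0711.4990 — 4 statements merged into one kernel-verified Lean document; each statement's English description precedes it below -/
import Mathlib

section
/- A context-free language L over a finite alphabet Σ is bounded if and only if L has polynomial growth. -/
open Computability

/-- The number of words of length `m` in the language `L`. -/
noncomputable def Language.growthCount {α : Type*} (L : Language α) (m : ℕ) : ℕ :=
  {w ∈ (L : Set (List α)) | w.length = m}.ncard

/-- `L` has polynomial growth: there is a polynomial `p` with `|L ∩ Σ^m| ≤ p(m)` for all `m`. -/
def Language.HasPolynomialGrowth {α : Type*} (L : Language α) : Prop :=
  ∃ p : Polynomial ℕ, ∀ m : ℕ, L.growthCount m ≤ p.eval m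

/-- `L` is bounded: `L ⊆ w₁* w₂* ⋯ w_k*` for some finitely many words `w₁, …, w_k`. -/
def Language.IsBounded {α : Type*} (L : Language α) : Prop :=
  ∃ (k : ℕ) (w : Fin k → List α),
    L ≤ (List.ofFn fun i => ({w i} : Language α)∗).prod

namespace Language

variable {α : Type*}

/-- The language `w₁* w₂* ⋯ w_k*` of a list of words. -/
def starProd (ws : List (List α)) : Language α :=
  (ws.map fun w => ({w} : Language α)∗).prod

lemma isBounded_iff_exists_starProd {L : Language α} :
    L.IsBounded ↔ ∃ ws, L ≤ starProd ws := by
  constructor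
  · rintro ⟨k, w, h⟩
    exact ⟨List.ofFn w, by simpa [starProd, List.map_ofFn, Function.comp_def] using h⟩
  · rintro ⟨ws, h⟩
    refine ⟨ws.length, ws.get, ?_⟩
    rwa [starProd, ← List.ofFn_get ws, List.map_ofFn] at h

lemma mem_kstar_singleton {w x : List α} :
    x ∈ ({w} : Language α)∗ ↔ ∃ n, x = (List.replicate n w).flatten := by
  rw [mem_kstar]
  constructor
  · rintro ⟨l, rfl, h⟩
    exact ⟨l.length, by rw [← List.eq_replicate_of_mem h]⟩
  · rintro ⟨n, rfl⟩
    exact ⟨_, rfl, fun y hy => List.eq_of_mem_replicate hy⟩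

lemma starProd_append (l l' : List (List α)) :
    starProd (l ++ l') = starProd l * starProd l' := by
  simp [starProd]

lemma nil_mem_starProd (l : List (List α)) : [] ∈ starProd l := by
  induction l with
  | nil => simp [starProd]
  | cons w l ih =>
    simp only [starProd, List.map_cons, List.prod_cons] at ih ⊢
    exact mem_mul.2 ⟨[], nil_mem_kstar _, [], ih, rfl⟩

lemma IsBounded.mono {L M : Language α} (hM : M.IsBounded) (h : L ≤ M) : L.IsBounded := by
  obtain ⟨k, w, hw⟩ := hM
  exact ⟨k, w, h.trans hw⟩

lemma IsBounded.mul {L M : Language α} (hL : L.IsBounded) (hM : M.IsBounded) :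
    (L * M).IsBounded := by
  rw [isBounded_iff_exists_starProd] at *
  obtain ⟨l, hl⟩ := hL
  obtain ⟨l', hl'⟩ := hM
  refine ⟨l ++ l', ?_⟩
  rw [starProd_append]
  rintro _ ⟨a, ha, b, hb, rfl⟩
  exact ⟨a, hl ha, b, hl' hb, rfl⟩

lemma IsBounded.add {L M : Language α} (hL : L.IsBounded) (hM : M.IsBounded) :
    (L + M).IsBounded := by
  rw [isBounded_iff_exists_starProd] at *
  obtain ⟨l, hl⟩ := hL
  obtain ⟨l', hl'⟩ := hM
  refine ⟨l ++ l', ?_⟩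
  rw [starProd_append]
  rintro a (ha | ha)
  · exact ⟨a, hl ha, [], nil_mem_starProd _, by simp⟩
  · exact ⟨[], nil_mem_starProd _, a, hl' ha, by simp⟩

lemma isBounded_kstar_singleton (w : List α) : (({w} : Language α)∗).IsBounded :=
  isBounded_iff_exists_starProd.2 ⟨[w], by simp [starProd]⟩

lemma isBounded_singleton (w : List α) : ({w} : Language α).IsBounded :=
  (isBounded_kstar_singleton w).mono fun x hx =>
    mem_kstar_singleton.2 ⟨1, by simpa using Set.mem_singleton_iff.1 hx⟩

lemma isBounded_of_forall_notMem {L : Language α} (h : ∀ w, w ∉ L) : L.IsBounded :=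
  (isBounded_singleton []).mono fun w hw => absurd hw (h w)

lemma isBounded_biUnion {ι : Type*} {s : Set ι} (hs : s.Finite) {L : ι → Language α}
    (h : ∀ i ∈ s, (L i).IsBounded) : IsBounded {w | ∃ i ∈ s, w ∈ L i} := by
  induction s, hs using Set.Finite.induction_on with
  | empty => exact isBounded_of_forall_notMem (by rintro w ⟨i, hi, -⟩; exact hi)
  | @insert a s _ _ ih =>
    refine ((h a (by simp)).add (ih fun i hi => h i (by simp [hi]))).mono ?_
    rintro w ⟨i, rfl | hi, hw⟩
    · exact Or.inl hw
    · exact Or.inr ⟨i, hi, hw⟩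

lemma exists_eq_flatten_replicate_append_of_commute {x₀ : List α} (h₀ : x₀ ≠ []) (x : List α)
    (h : x ++ x₀ = x₀ ++ x) : ∃ n, ∃ r, r <+: x₀ ∧ x = (List.replicate n x₀).flatten ++ r := by
  rcases List.append_eq_append_iff.1 h with ⟨r, hr, -⟩ | ⟨y, rfl, -⟩
  · exact ⟨0, x, ⟨r, hr.symm⟩, by simp⟩
  · have hy : y ++ x₀ = x₀ ++ y := by simpa using h
    have : y.length < (x₀ ++ y).length := by
      have := List.length_pos_iff.2 h₀
      simp; omega
    obtain ⟨n, r, hr, e⟩ := exists_eq_flatten_replicate_append_of_commute h₀ y hy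
    exact ⟨n + 1, r, hr, by simp [List.replicate_succ, ← e]⟩
termination_by x.length

/-- A language of pairwise commuting words is bounded. -/
lemma isBounded_of_commute {L : Language α} (h : ∀ x ∈ L, ∀ y ∈ L, x ++ y = y ++ x) :
    L.IsBounded := by
  by_cases hL : ∃ x₀ ∈ L, x₀ ≠ []
  · obtain ⟨x₀, hx₀, h₀⟩ := hL
    refine ((isBounded_kstar_singleton x₀).mul
      (isBounded_biUnion x₀.inits.finite_toSet fun r _ => isBounded_singleton r)).mono ?_
    intro x hx
    obtain ⟨n, r, hr, rfl⟩ :=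
      exists_eq_flatten_replicate_append_of_commute h₀ x (h x hx x₀ hx₀)
    exact ⟨_, mem_kstar_singleton.2 ⟨n, rfl⟩, r, ⟨r, by simpa using hr, rfl⟩, rfl⟩
  · push Not at hL
    exact (isBounded_singleton []).mono hL

lemma exists_finset_starProd (ws : List (List α)) (m : ℕ) :
    ∃ T : Finset (List α), T.card ≤ (m + 1) ^ ws.length ∧
      ∀ u ∈ starProd ws, u.length ≤ m → u ∈ T := by
  classical
  induction ws with
  | nil => exact ⟨{[]}, by simp, by simp [starProd]⟩
  | cons w ws ih =>
    obtain ⟨T, hT, hm⟩ := ih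
    refine ⟨Finset.image₂ (fun e u => (List.replicate e w).flatten ++ u)
      (Finset.range (m + 1)) T, ?_, ?_⟩
    · refine (Finset.card_image₂_le _ _ _).trans ?_
      rw [Finset.card_range, List.length_cons, pow_succ']
      exact Nat.mul_le_mul_left _ hT
    · rintro _ ⟨a, ha, b, hb, rfl⟩ hl
      obtain ⟨n, rfl⟩ := mem_kstar_singleton.1 ha
      simp only [List.length_append, List.length_flatten, List.map_replicate,
        List.sum_replicate, smul_eq_mul] at hl
      have hbT := hm b hb (by omega)
      rcases eq_or_ne w [] with rfl | hw
      · exact Finset.mem_image₂.2 ⟨0, by simp, b, hbT, by simp⟩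
      · have := List.length_pos_iff.2 hw
        refine Finset.mem_image₂.2 ⟨n, Finset.mem_range.2 ?_, b, hbT, rfl⟩
        nlinarith

lemma IsBounded.hasPolynomialGrowth {L : Language α} (hL : L.IsBounded) :
    L.HasPolynomialGrowth := by
  obtain ⟨ws, h⟩ := isBounded_iff_exists_starProd.1 hL
  refine ⟨(Polynomial.X + 1) ^ ws.length, fun m => ?_⟩
  obtain ⟨T, hT, hm⟩ := exists_finset_starProd ws m
  simp only [Polynomial.eval_pow, Polynomial.eval_add, Polynomial.eval_X, Polynomial.eval_one]
  refine le_trans ?_ hT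
  rw [growthCount, ← Set.ncard_coe_finset]
  exact Set.ncard_le_ncard (fun u hu => hm u (h hu.1) hu.2.le) T.finite_toSet

end Language

lemma Polynomial.exists_eval_lt_two_pow (p : Polynomial ℕ) : ∃ n : ℕ, p.eval n < 2 ^ n := by
  have h : (fun n : ℕ => ((p.eval n : ℕ) : ℝ)) =o[Filter.atTop] fun n : ℕ => (2 : ℝ) ^ n := by
    induction p using Polynomial.induction_on' with
    | add p q hp hq => simpa using hp.add hq
    | monomial k a =>
      simpa using (isLittleO_pow_const_const_pow_of_one_lt (R := ℝ) k one_lt_two).const_mul_left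
        (a : ℝ)
  obtain ⟨n, hn⟩ := (h.bound (show (0 : ℝ) < 1 / 2 by norm_num)).exists
  refine ⟨n, ?_⟩
  have h2 : (0 : ℝ) < 2 ^ n := by positivity
  have : ((p.eval n : ℕ) : ℝ) < 2 ^ n := by
    simp only [Real.norm_natCast, norm_pow, Real.norm_ofNat] at hn
    linarith
  exact_mod_cast this

section Pumping

variable {α : Type*}

/-- The word `U b₁ ⋯ U bₙ z V bₙ ⋯ V b₁`. -/
def nestedWord (U V : Bool → List α) (z : List α) : List Bool → List α
  | [] => z
  | b :: l => U b ++ nestedWord U V z l ++ V b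

variable {U V : Bool → List α} {z : List α}

lemma length_nestedWord (hU : ∀ b, (U b).length = (U true).length)
    (hV : ∀ b, (V b).length = (V true).length) (l : List Bool) :
    (nestedWord U V z l).length =
      z.length + ((U true).length + (V true).length) * l.length := by
  induction l with
  | nil => simp [nestedWord]
  | cons b l ih => simp only [nestedWord, List.length_append, ih, hU b, hV b, List.length_cons]; ring

lemma nestedWord_injOn (hU : ∀ b, (U b).length = (U true).length)
    (hV : ∀ b, (V b).length = (V true).length) (h : ∀ b c, U b = U c → V b = V c → b = c)
    (l l' : List Bool) (hl : l.length = l'.length)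
    (e : nestedWord U V z l = nestedWord U V z l') : l = l' := by
  induction l generalizing l' with
  | nil => exact (List.length_eq_zero_iff.1 hl.symm).symm
  | cons b l ih =>
    cases l' with
    | nil => simp at hl
    | cons c l' =>
      simp only [List.length_cons, Nat.add_right_cancel_iff] at hl
      simp only [nestedWord] at e
      have hlen : (nestedWord U V z l).length = (nestedWord U V z l').length := by
        rw [length_nestedWord hU hV, length_nestedWord hU hV, hl]
      obtain ⟨e₁, eV⟩ := List.append_inj e (by simp [hlen, hU b, hU c])
      obtain ⟨eU, e₂⟩ := List.append_inj e₁ (by rw [hU b, hU c])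
      rw [h b c eU eV, ih l' hl e₂]

/-- A language of polynomial growth does not contain all the words obtained by nesting two
different pairs of words with equal lengths. -/
lemma Language.HasPolynomialGrowth.eq_of_nestedWord_mem [Finite α] {L : Language α}
    (hL : L.HasPolynomialGrowth) {p q : List α}
    (hU : ∀ b, (U b).length = (U true).length) (hV : ∀ b, (V b).length = (V true).length)
    (hmem : ∀ l, p ++ nestedWord U V z l ++ q ∈ L) :
    U true = U false ∧ V true = V false := by
  by_contra hne
  have h : ∀ b c, U b = U c → V b = V c → b = c := by
    rintro (_ | _) (_ | _) h₁ h₂ <;> first | rfl | (exfalso; exact hne (by simp [h₁, h₂]))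
  obtain ⟨P, hP⟩ := hL
  set c := p.length + z.length + q.length
  set d := (U true).length + (V true).length
  obtain ⟨n, hn⟩ := (P.comp (Polynomial.C c + Polynomial.C d * Polynomial.X)).exists_eval_lt_two_pow
  simp only [Polynomial.eval_comp, Polynomial.eval_add, Polynomial.eval_C, Polynomial.eval_mul,
    Polynomial.eval_X] at hn
  refine absurd (hP (c + d * n)) (not_le.2 (hn.trans_le ?_))
  have hfin : {w ∈ (L : Set (List α)) | w.length = c + d * n}.Finite :=
    (List.finite_length_eq α (c + d * n)).subset fun w hw => hw.2
  let f : (Fin n → Bool) → List α := fun b => p ++ nestedWord U V z (List.ofFn b) ++ q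
  have hf : Function.Injective f := by
    intro a b hab
    have := List.append_cancel_left (List.append_cancel_right hab)
    exact List.ofFn_injective (nestedWord_injOn hU hV h _ _ (by simp) this)
  calc 2 ^ n = (Set.range f).ncard := by
        rw [← Set.image_univ, Set.ncard_image_of_injective _ hf]
        simp [Set.ncard_univ]
    _ ≤ _ := by
        refine Set.ncard_le_ncard ?_ hfin
        rintro _ ⟨b, rfl⟩
        refine ⟨hmem _, ?_⟩
        simp only [f, List.length_append, length_nestedWord hU hV, List.length_ofFn, c, d]
        ring

end Pumping

namespace ContextFreeGrammar

variable {T : Type*} {g : ContextFreeGrammar T}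

/-- `g.Yields S s w` means that `w` is derived from `s` by a forest of parse trees all of whose
nonterminals lie in `S`. -/
inductive Yields (g : ContextFreeGrammar T) (S : Set g.NT) :
    List (Symbol T g.NT) → List T → Prop
  | nil : Yields g S [] []
  | terminal (a : T) {s : List (Symbol T g.NT)} {w : List T} (h : Yields g S s w) :
      Yields g S (.terminal a :: s) (a :: w)
  | nonterminal {r : ContextFreeRule T g.NT} (hr : r ∈ g.rules) (hS : r.input ∈ S)
      {s : List (Symbol T g.NT)} {w₁ w₂ : List T} (h₁ : Yields g S r.output w₁)
      (h₂ : Yields g S s w₂) : Yields g S (.nonterminal r.input :: s) (w₁ ++ w₂)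

lemma Yields.append {S : Set g.NT} {s t : List (Symbol T g.NT)} {w v : List T}
    (hs : g.Yields S s w) (ht : g.Yields S t v) : g.Yields S (s ++ t) (w ++ v) := by
  induction hs with
  | nil => exact ht
  | terminal a _ ih => exact ih.terminal a
  | nonterminal hr hS h₁ _ _ ih₂ =>
    rw [List.append_assoc]
    exact .nonterminal hr hS h₁ ih₂

lemma Yields.exists_of_append {S : Set g.NT} {s t : List (Symbol T g.NT)} {w : List T}
    (h : g.Yields S (s ++ t) w) :
    ∃ w₁ w₂, w = w₁ ++ w₂ ∧ g.Yields S s w₁ ∧ g.Yields S t w₂ := by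
  induction s generalizing w with
  | nil => exact ⟨[], w, rfl, .nil, h⟩
  | cons x s ih =>
    cases h with
    | terminal a h =>
      obtain ⟨w₁, w₂, rfl, h₁, h₂⟩ := ih h
      exact ⟨a :: w₁, w₂, rfl, h₁.terminal a, h₂⟩
    | nonterminal hr hS hw h =>
      obtain ⟨w₁, w₂, rfl, h₁, h₂⟩ := ih h
      exact ⟨_, w₂, (List.append_assoc ..).symm, .nonterminal hr hS hw h₁, h₂⟩

lemma Yields.derives {S : Set g.NT} {s : List (Symbol T g.NT)} {w : List T}
    (h : g.Yields S s w) : g.Derives s (w.map .terminal) := by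
  induction h with
  | nil => rfl
  | terminal a _ ih => exact ih.append_left [.terminal a]
  | @nonterminal r hr _ s w₁ w₂ _ _ ih₁ ih₂ =>
    rw [List.map_append]
    have h : g.Produces (.nonterminal r.input :: s) (r.output ++ s) := ⟨r, hr, .head s⟩
    exact (h.trans_derives (ih₁.append_right s)).trans (ih₂.append_left _)

lemma yields_map_terminal (S : Set g.NT) (w : List T) : g.Yields S (w.map .terminal) w := by
  induction w with
  | nil => exact .nil
  | cons a w ih => exact ih.terminal a

lemma Derives.yields {S : Set g.NT} (hS : ∀ r ∈ g.rules, r.input ∈ S)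
    {s : List (Symbol T g.NT)} {w : List T} (h : g.Derives s (w.map .terminal)) :
    g.Yields S s w := by
  induction h using Relation.ReflTransGen.head_induction_on with
  | refl => exact yields_map_terminal S w
  | head h _ ih =>
    obtain ⟨r, hr, hrw⟩ := h
    obtain ⟨p, q, rfl, rfl⟩ := hrw.exists_parts
    obtain ⟨w', w₃, rfl, h', h₃⟩ := ih.exists_of_append
    obtain ⟨w₁, w₂, rfl, h₁, h₂⟩ := h'.exists_of_append
    refine (h₁.append ?_).append h₃
    simpa using Yields.nonterminal hr (hS r hr) h₂ .nil

/-- Either a parse forest avoids `A`, or it contains an occurrence of `A` below which `A` does not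
occur again. -/
lemma Yields.avoids_or_exists_last {S : Set g.NT} (A : g.NT) {s : List (Symbol T g.NT)}
    {w : List T} (h : g.Yields S s w) :
    g.Yields (S \ {A}) s w ∨ ∃ r ∈ g.rules, r.input = A ∧ ∃ x w' y : List T,
      w = x ++ w' ++ y ∧ g.Yields (S \ {A}) r.output w' ∧
      g.Derives s (x.map .terminal ++ [.nonterminal A] ++ y.map .terminal) := by
  induction h with
  | nil => exact .inl .nil
  | terminal a _ ih =>
    rcases ih with ih | ⟨r, hr, hA, x, w', y, rfl, hw', hd⟩
    · exact .inl (ih.terminal a)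
    · exact .inr ⟨r, hr, hA, a :: x, w', y, rfl, hw', hd.append_left [.terminal a]⟩
  | @nonterminal r hr hS s w₁ w₂ h₁ h₂ ih₁ ih₂ =>
    have hp : g.Produces (.nonterminal r.input :: s) (r.output ++ s) := ⟨r, hr, .head s⟩
    rcases ih₂ with ih₂ | ⟨r', hr', hA, x, w', y, rfl, hw', hd⟩
    · rcases ih₁ with ih₁ | ⟨r', hr', hA, x, w', y, rfl, hw', hd⟩
      · by_cases hA : r.input = A
        · refine .inr ⟨r, hr, hA, [], w₁, w₂, rfl, ih₁, ?_⟩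
          rw [hA]
          exact h₂.derives.append_left [.nonterminal A]
        · exact .inl (.nonterminal hr (Set.mem_sdiff_singleton.2 ⟨hS, hA⟩) ih₁ ih₂)
      · refine .inr ⟨r', hr', hA, x, w', y ++ w₂, by simp, hw', ?_⟩
        have := (hp.trans_derives (hd.append_right s)).trans (h₂.derives.append_left _)
        simpa using this
    · refine .inr ⟨r', hr', hA, w₁ ++ x, w', y, by simp, hw', ?_⟩
      have := (hp.trans_derives (h₁.derives.append_right s)).trans (hd.append_left _)
      simpa using this

/-- `s` occurs in a sentential form of `g`, surrounded by terminals. -/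
def Reachable (g : ContextFreeGrammar T) (s : List (Symbol T g.NT)) : Prop :=
  ∃ p q : List T, g.Derives [.nonterminal g.initial]
    (p.map .terminal ++ s ++ q.map .terminal)

lemma Reachable.derives {s t : List (Symbol T g.NT)} (h : g.Reachable s) (hd : g.Derives s t) :
    g.Reachable t := by
  obtain ⟨p, q, h⟩ := h
  exact ⟨p, q, h.trans ((hd.append_left _).append_right _)⟩

lemma Reachable.of_append_left {s : List (Symbol T g.NT)} {w : List T}
    (h : g.Reachable (w.map .terminal ++ s)) : g.Reachable s := by
  obtain ⟨p, q, h⟩ := h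
  exact ⟨p ++ w, q, by simpa using h⟩

lemma Reachable.of_append_right {s : List (Symbol T g.NT)} {w : List T}
    (h : g.Reachable (s ++ w.map .terminal)) : g.Reachable s := by
  obtain ⟨p, q, h⟩ := h
  exact ⟨p, w ++ q, by simpa using h⟩

lemma derives_nestedWord {A : g.NT} {U V : Bool → List T} {z : List T}
    (hUV : ∀ b, g.Derives [.nonterminal A]
      ((U b).map .terminal ++ [.nonterminal A] ++ (V b).map .terminal))
    (hz : g.Derives [.nonterminal A] (z.map .terminal)) (l : List Bool) :
    g.Derives [.nonterminal A] ((nestedWord U V z l).map .terminal) := by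
  induction l with
  | nil => exact hz
  | cons b l ih =>
    simp only [nestedWord, List.map_append]
    exact (hUV b).trans ((ih.append_left _).append_right _)

/-- In a grammar generating a language of polynomial growth, the loops `A ⇒* u A v` at a useful
nonterminal `A` have pairwise commuting left parts and pairwise commuting right parts. -/
lemma append_comm_of_hasPolynomialGrowth [Finite T] (hg : g.language.HasPolynomialGrowth)
    {A : g.NT} (hA : g.Reachable [.nonterminal A]) {z : List T}
    (hz : g.Derives [.nonterminal A] (z.map .terminal)) {u v u' v' : List T}
    (h : g.Derives [.nonterminal A] (u.map .terminal ++ [.nonterminal A] ++ v.map .terminal))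
    (h' : g.Derives [.nonterminal A] (u'.map .terminal ++ [.nonterminal A] ++ v'.map .terminal)) :
    u ++ u' = u' ++ u ∧ v ++ v' = v' ++ v := by
  obtain ⟨p, q, hpq⟩ := hA
  let U : Bool → List T := fun b => if b then u ++ u' else u' ++ u
  let V : Bool → List T := fun b => if b then v' ++ v else v ++ v'
  have hUV : ∀ b, g.Derives [.nonterminal A]
      ((U b).map .terminal ++ [.nonterminal A] ++ (V b).map .terminal) := by
    rintro (_ | _)
    · simpa [U, V] using h'.trans ((h.append_left _).append_right _)
    · simpa [U, V] using h.trans ((h'.append_left _).append_right _)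
  have := hg.eq_of_nestedWord_mem (U := U) (V := V) (z := z) (p := p) (q := q)
    (by rintro (_ | _) <;> simp [U, add_comm]) (by rintro (_ | _) <;> simp [V, add_comm])
    fun l => by
      rw [mem_language_iff, List.map_append, List.map_append]
      exact hpq.trans (((derives_nestedWord hUV hz l).append_left _).append_right _)
  exact ⟨by simpa [U] using this.1, by simpa [V] using this.2.symm⟩

lemma isBounded_setOf_yields_append {S : Set g.NT} {s t : List (Symbol T g.NT)}
    (hs : g.Reachable s → Language.IsBounded {w | g.Yields S s w})
    (ht : g.Reachable t → Language.IsBounded {w | g.Yields S t w})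
    (h : g.Reachable (s ++ t)) : Language.IsBounded {w | g.Yields S (s ++ t) w} := by
  by_cases hw : ∃ w, g.Yields S (s ++ t) w
  · obtain ⟨w, hw⟩ := hw
    obtain ⟨w₁, w₂, -, h₁, h₂⟩ := hw.exists_of_append
    refine ((hs (h.derives (h₂.derives.append_left s)).of_append_right).mul
      (ht (h.derives (h₁.derives.append_right t)).of_append_left)).mono ?_
    intro v hv
    obtain ⟨v₁, v₂, rfl, hv₁, hv₂⟩ := Yields.exists_of_append hv
    exact ⟨v₁, hv₁, v₂, hv₂, rfl⟩
  · push Not at hw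
    exact Language.isBounded_of_forall_notMem hw

theorem isBounded_setOf_yields [Finite T] (hg : g.language.HasPolynomialGrowth)
    {S : Set g.NT} (hS : S.Finite) (s : List (Symbol T g.NT)) (hs : g.Reachable s) :
    Language.IsBounded {w | g.Yields S s w} := by
  induction hn : S.ncard using Nat.strong_induction_on generalizing S s with
  | _ n ih =>
  subst hn
  have single (A : g.NT) (hA : g.Reachable [.nonterminal A]) :
      Language.IsBounded {w | g.Yields S [.nonterminal A] w} := by
    by_cases hw : ∃ z, g.Yields S [.nonterminal A] z
    · obtain ⟨z, hz⟩ := hw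
      have hAS : A ∈ S := by cases hz; assumption
      have hcard : (S \ {A}).ncard < S.ncard := Set.ncard_sdiff_singleton_lt_of_mem hAS hS
      let X : Language T := {u | ∃ v : List T, g.Derives [.nonterminal A]
        (u.map .terminal ++ [.nonterminal A] ++ v.map .terminal)}
      let Y : Language T := {v | ∃ u : List T, g.Derives [.nonterminal A]
        (u.map .terminal ++ [.nonterminal A] ++ v.map .terminal)}
      have hX : X.IsBounded := Language.isBounded_of_commute fun _ ⟨_, h⟩ _ ⟨_, h'⟩ =>
        (append_comm_of_hasPolynomialGrowth hg hA hz.derives h h').1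
      have hY : Y.IsBounded := Language.isBounded_of_commute fun _ ⟨_, h⟩ _ ⟨_, h'⟩ =>
        (append_comm_of_hasPolynomialGrowth hg hA hz.derives h h').2
      have hM := Language.isBounded_biUnion (s := {r | r ∈ g.rules ∧ r.input = A})
        (g.rules.finite_toSet.subset fun r hr => hr.1)
        (L := fun r => {w | g.Yields (S \ {A}) r.output w}) fun r ⟨hr, hrA⟩ =>
          ih _ hcard hS.sdiff r.output (hA.derives
            (Produces.single ⟨r, hr, hrA ▸ ContextFreeRule.Rewrites.input_output⟩)) rfl
      refine ((hX.mul hM).mul hY).mono fun w hw => ?_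
      rcases Yields.avoids_or_exists_last A hw with h | ⟨r, hr, hrA, x, w', y, rfl, hw', hd⟩
      · cases h with
        | nonterminal _ h => exact absurd rfl h.2
      · exact ⟨_, ⟨x, ⟨y, hd⟩, w', ⟨r, ⟨hr, hrA⟩, hw'⟩, rfl⟩, y, ⟨x, hd⟩, rfl⟩
    · push Not at hw
      exact Language.isBounded_of_forall_notMem hw
  induction s with
  | nil =>
    refine (Language.isBounded_singleton []).mono fun w hw => ?_
    cases hw
    rfl
  | cons x s ihs =>
    refine isBounded_setOf_yields_append (s := [x]) (fun hx => ?_) ihs hs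
    cases x with
    | nonterminal A => exact single A hx
    | terminal a =>
      refine (Language.isBounded_singleton [a]).mono fun w hw => ?_
      cases hw with
      | terminal _ h => cases h; rfl

end ContextFreeGrammar

/-- A context-free language over a finite alphabet is bounded if and only if it has
polynomial growth. -/
theorem contextFree_isBounded_iff_hasPolynomialGrowth {α : Type} [Fintype α]
    (L : Language α) (hL : L.IsContextFree) :
    L.IsBounded ↔ L.HasPolynomialGrowth := by
  refine ⟨Language.IsBounded.hasPolynomialGrowth, fun hg => ?_⟩
  obtain ⟨g, rfl⟩ := hL
  refine (ContextFreeGrammar.isBounded_setOf_yields hg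
    (g.rules.finite_toSet.image ContextFreeRule.input) [.nonterminal g.initial]
    ⟨[], [], by simpa using ContextFreeGrammar.Derives.refl _⟩).mono fun w hw => ?_
  exact ContextFreeGrammar.Derives.yields (fun r hr => Set.mem_image_of_mem _ hr) hw
end

section
/- Let M = (Q, Σ, δ, q₀, F) be an NFA in which every state is accessible and co-accessible. If L(M) has polynomial growth, then for every state q ∈ Q the language L_q is commutative. -/
open Computability

/-- `L` is commutative: `L ⊆ u*` for some word `u`. -/
def Language.IsCommutativeLang {α : Type*} (L : Language α) : Prop :=
  ∃ u : List α, L ≤ ({u} : Language α)∗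

/-- The state `q` of the NFA `M` is accessible: it is reachable from the start by some word. -/
def NFA.Accessible {α σ : Type*} (M : NFA α σ) (q : σ) : Prop :=
  ∃ w : List α, q ∈ M.eval w

/-- The state `q` is co-accessible: some accepting state is reachable from `q` by some word. -/
def NFA.CoAccessible {α σ : Type*} (M : NFA α σ) (q : σ) : Prop :=
  ∃ w : List α, (M.evalFrom {q} w ∩ M.accept).Nonempty

/-- `L_q`: the language of words that can take `M` from state `q` back to state `q`. -/
def NFA.loopLang {α σ : Type*} (M : NFA α σ) (q : σ) : Language α :=
  {w | q ∈ M.evalFrom {q} w}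

namespace List

variable {α : Type*}

theorem length_flatten_replicate (w : List α) (n : ℕ) :
    (replicate n w).flatten.length = n * w.length := by
  simp

theorem append_flatten_replicate_comm {x w : List α} (h : x ++ w = w ++ x) (n : ℕ) :
    x ++ (replicate n w).flatten = (replicate n w).flatten ++ x := by
  induction n with
  | zero => simp
  | succ n ih =>
    rw [replicate_succ, flatten_cons, ← append_assoc, h, append_assoc, ih, append_assoc]

/-- A word commuting with a nonempty word `w` is a prefix of every sufficiently high power
of `w`. -/
theorem prefix_flatten_replicate_of_append_comm {x w : List α} (hw : w ≠ [])
    (h : x ++ w = w ++ x) {n : ℕ} (hn : x.length ≤ n) :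
    x <+: (replicate n w).flatten := by
  refine prefix_of_prefix_length_le (prefix_append x (replicate n w).flatten)
    (append_flatten_replicate_comm h n ▸ prefix_append _ _) ?_
  rw [length_flatten_replicate]
  exact hn.trans (Nat.le_mul_of_pos_right n (length_pos_of_ne_nil hw))

/-- The words commuting with a fixed nonempty word are all powers of a single word. -/
theorem exists_mem_kstar_of_append_comm {w : List α} (hw : w ≠ []) :
    ∃ u : List α, ∀ x : List α, x ++ w = w ++ x → x ∈ ({u} : Language α)∗ := by
  classical
  have hex : ∃ k, ∃ u : List α, u ≠ [] ∧ u ++ w = w ++ u ∧ u.length = k := ⟨_, w, hw, rfl, rfl⟩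
  obtain ⟨u, hu, huw, hlen⟩ := Nat.find_spec hex
  refine ⟨u, fun x hx => ?_⟩
  induction hk : x.length using Nat.strong_induction_on generalizing x with
  | _ k ih =>
    subst hk
    by_cases hx0 : x = []
    · subst hx0
      exact Language.nil_mem_kstar _
    have hle : u.length ≤ x.length := hlen ▸ Nat.find_min' hex ⟨x, hx0, hx, rfl⟩
    obtain ⟨z, rfl⟩ : u <+: x :=
      prefix_of_prefix_length_le (prefix_flatten_replicate_of_append_comm hw huw hle)
        (prefix_flatten_replicate_of_append_comm hw hx le_rfl) hle
    have hz : z ++ w = w ++ z := by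
      rw [append_assoc, ← append_assoc w, ← huw, append_assoc] at hx
      exact append_cancel_left hx
    have hu_pos := length_pos_of_ne_nil hu
    obtain ⟨L, rfl, hL⟩ := Language.mem_kstar.1 (ih z.length (by simp; omega) z hz rfl)
    exact Language.mem_kstar.2 ⟨u :: L, by simp, List.forall_mem_cons.2 ⟨rfl, hL⟩⟩

/-- Substituting two distinct words of the same length for the letters of a binary alphabet is
injective. -/
theorem flatMap_cond_injective {a b : List α} (hab : a ≠ b) (hlen : a.length = b.length)
    (ha : a ≠ []) : Function.Injective fun l : List Bool => l.flatMap fun c => cond c a b := by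
  have hb : b ≠ [] := ne_nil_of_length_pos (hlen ▸ length_pos_of_ne_nil ha)
  intro l
  induction l with
  | nil =>
    rintro (_ | ⟨c, l'⟩) h
    · rfl
    · cases c <;> simp_all
  | cons c l ih =>
    rintro (_ | ⟨c', l'⟩) h
    · cases c <;> simp_all
    · simp only [flatMap_cons] at h
      obtain ⟨h₁, h₂⟩ := append_inj h (by cases c <;> cases c' <;> simp [hlen])
      rw [ih h₂]
      cases c <;> cases c' <;> simp_all

theorem length_flatMap_cond {a b : List α} (hlen : a.length = b.length) (l : List Bool) :
    (l.flatMap fun c => cond c a b).length = l.length * a.length := by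
  induction l with
  | nil => simp
  | cons c l ih => cases c <;> simp [ih, hlen] <;> ring

end List

/-- A language over a finite alphabet containing all words `s l t`, with `l` a product of copies of
two distinct words of the same length, does not have polynomial growth. -/
theorem Language.not_hasPolynomialGrowth_of_flatMap_mem {α : Type*} [Finite α] {L : Language α}
    {s t a b : List α} (hab : a ≠ b) (hlen : a.length = b.length)
    (h : ∀ l : List Bool, s ++ (l.flatMap fun c => cond c a b) ++ t ∈ L) :
    ¬ L.HasPolynomialGrowth := by
  rintro ⟨p, hp⟩
  have ha : a ≠ [] := by
    rintro rfl
    exact hab (List.length_eq_zero_iff.1 hlen.symm).symm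
  have hcount (n : ℕ) : 2 ^ n ≤ p.eval (s.length + n * a.length + t.length) := by
    refine le_trans ?_ (hp _)
    let f : List.Vector Bool n → List α := fun v => s ++ (v.1.flatMap fun c => cond c a b) ++ t
    have hf : Function.Injective f := fun v w hvw =>
      Subtype.ext <| List.flatMap_cond_injective hab hlen ha <|
        List.append_cancel_left (List.append_cancel_right hvw)
    have hcard : (Set.range f).ncard = 2 ^ n := by
      rw [← Set.image_univ, Set.ncard_image_of_injective _ hf, Set.ncard_univ]
      simp
    rw [← hcard, Language.growthCount]
    refine Set.ncard_le_ncard ?_ ((List.finite_length_eq α _).subset fun w hw => hw.2)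
    rintro _ ⟨v, rfl⟩
    exact ⟨h v.1, by simp [f, List.length_flatMap_cond hlen, v.2, -List.length_flatMap, add_assoc]⟩
  let q : Polynomial ℝ := (p.map (Nat.castRingHom ℝ)).comp
    (Polynomial.C (s.length + t.length : ℝ) + Polynomial.C (a.length / Real.log 2) * Polynomial.X)
  have hlog : 0 < Real.log 2 := Real.log_pos one_lt_two
  have htend := (Polynomial.tendsto_div_exp_atTop q).comp
    (tendsto_natCast_atTop_atTop.atTop_mul_const hlog)
  obtain ⟨n, hn⟩ := (htend.eventually (gt_mem_nhds one_pos)).exists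
  have hq : q.eval (n * Real.log 2) = (p.eval (s.length + n * a.length + t.length) : ℕ) := by
    have harg : (s.length + t.length + a.length / Real.log 2 * (n * Real.log 2) : ℝ) =
        ((s.length + n * a.length + t.length : ℕ) : ℝ) := by
      push_cast
      field_simp
      ring
    simp only [q, Polynomial.eval_comp, Polynomial.eval_add, Polynomial.eval_C,
      Polynomial.eval_mul, Polynomial.eval_X, harg]
    exact Polynomial.eval_natCast_map (Nat.castRingHom ℝ) p _
  rw [Function.comp_apply, hq, Real.exp_nat_mul, Real.exp_log two_pos, div_lt_one (by positivity)]
    at hn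
  exact absurd (hcount n) (not_le.2 (by exact_mod_cast hn))

namespace NFA

variable {α σ : Type*} {M : NFA α σ}

theorem mem_evalFrom_append {S : Set σ} {q r : σ} {x y : List α} (hx : q ∈ M.evalFrom S x)
    (hy : r ∈ M.evalFrom {q} y) : r ∈ M.evalFrom S (x ++ y) := by
  rw [evalFrom_append]
  exact mem_evalFrom_iff_exists.2 ⟨q, hx, hy⟩

theorem append_mem_loopLang {q : σ} {x y : List α} (hx : x ∈ M.loopLang q)
    (hy : y ∈ M.loopLang q) : x ++ y ∈ M.loopLang q :=
  mem_evalFrom_append hx hy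

theorem flatMap_mem_loopLang {β : Type*} {q : σ} {f : β → List α} (hf : ∀ c, f c ∈ M.loopLang q)
    (l : List β) : l.flatMap f ∈ M.loopLang q := by
  induction l with
  | nil => exact Set.mem_singleton q
  | cons c l ih => exact append_mem_loopLang (hf c) ih

theorem append_comm_of_mem_loopLang [Finite α] {q : σ} (hacc : M.Accessible q)
    (hcoacc : M.CoAccessible q) (hpoly : M.accepts.HasPolynomialGrowth) {x y : List α}
    (hx : x ∈ M.loopLang q) (hy : y ∈ M.loopLang q) : x ++ y = y ++ x := by
  by_contra hne
  obtain ⟨s, hs⟩ := hacc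
  obtain ⟨t, r, hr, hracc⟩ := hcoacc
  refine Language.not_hasPolynomialGrowth_of_flatMap_mem (s := s) (t := t) hne
    (by simp [add_comm]) (fun l => ?_) hpoly
  refine ⟨r, hracc, mem_evalFrom_append (mem_evalFrom_append hs (flatMap_mem_loopLang ?_ l)) hr⟩
  rintro (_ | _)
  · exact append_mem_loopLang hy hx
  · exact append_mem_loopLang hx hy

end NFA

/-- If every state of the NFA `M` (with start state `q₀`) is accessible and co-accessible
and `L(M)` has polynomial growth, then for every state `q` the language `L_q` is
commutative. -/
theorem loopLang_isCommutative_of_hasPolynomialGrowth {α σ : Type*} [Fintype α] [Fintype σ]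
    (M : NFA α σ) (q₀ : σ) (hstart : M.start = {q₀})
    (hacc : ∀ q : σ, M.Accessible q) (hcoacc : ∀ q : σ, M.CoAccessible q)
    (hpoly : M.accepts.HasPolynomialGrowth) :
    ∀ q : σ, (M.loopLang q).IsCommutativeLang := by
  intro q
  by_cases hq : ∃ w ∈ M.loopLang q, w ≠ []
  · obtain ⟨w, hw, hne⟩ := hq
    obtain ⟨u, hu⟩ := List.exists_mem_kstar_of_append_comm hne
    exact ⟨u, fun x hx =>
      hu x (NFA.append_comm_of_mem_loopLang (hacc q) (hcoacc q) hpoly hx hw)⟩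
  · push Not at hq
    exact ⟨[], fun x hx => (hq x hx).symm ▸ Language.nil_mem_kstar _⟩
end

section
/- Let M = (Q, Σ, δ, q₀, F) be an NFA and let q ∈ Q be a state that is both accessible and co-accessible. If there exist words x, y ∈ L_q with xy ≠ yx, then L(M) has exponential growth. -/
open Computability

/-- `L` has exponential growth: for some real `r > 1`, `|L ∩ Σ^m| ≥ r^m` for infinitely many `m`. -/
def Language.HasExponentialGrowth {α : Type*} (L : Language α) : Prop :=
  ∃ r : ℝ, 1 < r ∧ {m : ℕ | r ^ m ≤ (L.growthCount m : ℝ)}.Infinite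

theorem NFA.mem_evalFrom_append_s3 {α σ : Type*} (M : NFA α σ) {S : Set σ} {s t : σ}
    {x y : List α} (hs : s ∈ M.evalFrom S x) (ht : t ∈ M.evalFrom {s} y) :
    t ∈ M.evalFrom S (x ++ y) := by
  rw [NFA.evalFrom_append, NFA.mem_evalFrom_iff_exists]
  exact ⟨s, hs, ht⟩

theorem NFA.append_mem_loopLang_s3 {α σ : Type*} (M : NFA α σ) {q : σ} {x y : List α}
    (hx : x ∈ M.loopLang q) (hy : y ∈ M.loopLang q) : x ++ y ∈ M.loopLang q :=
  M.mem_evalFrom_append_s3 hx hy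

theorem NFA.flatMap_mem_loopLang_s3 {α β σ : Type*} (M : NFA α σ) {q : σ} {f : β → List α}
    (hf : ∀ b, f b ∈ M.loopLang q) (l : List β) : l.flatMap f ∈ M.loopLang q := by
  induction l with
  | nil => exact Set.mem_singleton q
  | cons b l ih => exact M.append_mem_loopLang_s3 (hf b) ih

theorem List.length_flatMap_of_forall_length_eq {α β : Type*} {f : β → List α} {n : ℕ}
    (hf : ∀ b, (f b).length = n) (l : List β) : (l.flatMap f).length = l.length * n := by
  induction l with
  | nil => simp
  | cons b l ih => simp [hf, ih]; ring

/-- Concatenating the values of an injective block code is injective on words of equal length. -/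
theorem List.eq_of_flatMap_eq_flatMap {α β : Type*} {f : β → List α} {n : ℕ}
    (hf : ∀ b, (f b).length = n) (hinj : Function.Injective f) {l₁ l₂ : List β}
    (hlen : l₁.length = l₂.length) (h : l₁.flatMap f = l₂.flatMap f) : l₁ = l₂ := by
  induction l₁ generalizing l₂ with
  | nil => exact (List.length_eq_zero_iff.mp hlen.symm).symm
  | cons b l ih =>
    cases l₂ with
    | nil => simp at hlen
    | cons b' l' =>
      simp only [List.flatMap_cons] at h
      obtain ⟨hb, hl⟩ := List.append_inj h ((hf b).trans (hf b').symm)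
      rw [hinj hb, ih (by simpa using hlen) hl]

/-- A language that contains `p ++ w ++ s` for every concatenation `w` of values of a binary
block code with block length `n` has at least `2 ^ k` words of length `|p| + k * n + |s|`. -/
theorem Language.two_pow_le_growthCount {α : Type*} [Finite α] {L : Language α}
    {f : Bool → List α} {n : ℕ} (hf : ∀ b, (f b).length = n) (hinj : Function.Injective f)
    {p s : List α} (hL : ∀ l : List Bool, p ++ l.flatMap f ++ s ∈ L) (k : ℕ) :
    2 ^ k ≤ L.growthCount (p.length + k * n + s.length) := by
  let g : List.Vector Bool k → List α := fun l => p ++ l.toList.flatMap f ++ s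
  have hg : Function.Injective g := by
    intro l₁ l₂ h
    refine Subtype.ext (List.eq_of_flatMap_eq_flatMap hf hinj ?_ ?_)
    · exact l₁.2.trans l₂.2.symm
    · exact List.append_cancel_left (List.append_cancel_right h)
  have hcard : (Set.range g).ncard = 2 ^ k := by
    rw [Set.ncard_range_of_injective hg, Nat.card_eq_fintype_card, card_vector, Fintype.card_bool]
  rw [← hcard]
  refine Set.ncard_le_ncard ?_ ((List.finite_length_eq α _).subset fun w hw => hw.2)
  rintro _ ⟨l, rfl⟩
  refine ⟨hL _, ?_⟩
  simp [g, List.length_flatMap_of_forall_length_eq hf, add_assoc]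

/-- At least `2 ^ k` words of length `c + k * n` for every `k`, with `n > 0`, give exponential
growth. -/
theorem Language.hasExponentialGrowth_of_two_pow_le {α : Type*} {L : Language α} {c n : ℕ}
    (hn : 0 < n) (h : ∀ k, 2 ^ k ≤ L.growthCount (c + k * n)) : L.HasExponentialGrowth := by
  have hN : c + n ≠ 0 := by omega
  set r : ℝ := 2 ^ ((c + n : ℕ) : ℝ)⁻¹ with hr
  have hrN : r ^ (c + n) = 2 := Real.rpow_inv_natCast_pow (by norm_num) hN
  have hr1 : 1 < r := Real.one_lt_rpow (by norm_num) (by positivity)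
  refine ⟨r, hr1, Set.infinite_of_injective_forall_mem (f := fun k : ℕ => c + (k + 1) * n) ?_ ?_⟩
  · intro a b hab
    simpa [hn.ne'] using hab
  · intro k
    calc r ^ (c + (k + 1) * n) ≤ r ^ ((c + n) * (k + 1)) :=
          pow_le_pow_right₀ hr1.le (by nlinarith [Nat.zero_le (c * k)])
      _ = 2 ^ (k + 1) := by rw [pow_mul, hrN]
      _ ≤ _ := by exact_mod_cast h (k + 1)

/-- If `q` is an accessible and co-accessible state of the NFA `M` (with start state `q₀`)
and there are words `x, y ∈ L_q` with `xy ≠ yx`, then `L(M)` has exponential growth. -/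
theorem hasExponentialGrowth_of_noncommuting_loops {α σ : Type*} [Fintype α] [Fintype σ]
    (M : NFA α σ) (q₀ : σ) (hstart : M.start = {q₀}) (q : σ)
    (hq_acc : M.Accessible q) (hq_coacc : M.CoAccessible q)
    (x y : List α) (hx : x ∈ M.loopLang q) (hy : y ∈ M.loopLang q)
    (hxy : x ++ y ≠ y ++ x) :
    M.accepts.HasExponentialGrowth := by
  obtain ⟨p, hp⟩ := hq_acc
  obtain ⟨s, t, hts, ht⟩ := hq_coacc
  let f : Bool → List α := fun b => bif b then x ++ y else y ++ x
  have hlen : ∀ b, (f b).length = x.length + y.length := by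
    rintro (_ | _) <;> simp [f, add_comm]
  have hinj : Function.Injective f := by
    rintro (_ | _) (_ | _) h
    · rfl
    · exact absurd h.symm hxy
    · exact absurd h hxy
    · rfl
  have hloop : ∀ b, f b ∈ M.loopLang q := by
    rintro (_ | _)
    · exact M.append_mem_loopLang_s3 hy hx
    · exact M.append_mem_loopLang_s3 hx hy
  have hpos : 0 < x.length + y.length := by
    by_contra! h0
    have hx0 : x = [] := List.length_eq_zero_iff.mp (by omega)
    exact hxy (by simp [hx0])
  have hL : ∀ l : List Bool, p ++ l.flatMap f ++ s ∈ M.accepts := fun l =>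
    ⟨t, ht, M.mem_evalFrom_append_s3 (M.mem_evalFrom_append_s3 hp (M.flatMap_mem_loopLang_s3 hloop l)) hts⟩
  refine Language.hasExponentialGrowth_of_two_pow_le (c := p.length + s.length) hpos fun k => ?_
  rw [add_right_comm]
  exact Language.two_pow_le_growthCount hlen hinj hL k
end

section
/- Every regular language over a finite alphabet has either polynomial growth or exponential growth; no intermediate growth is possible. -/
open Computability

namespace DFA

variable {α σ : Type*} (M : DFA α σ)

/-- The last time at most `m` at which the run of `M` on `w` visits `q` (`0` if there is none),
together with the letter read at that time, if any. -/
noncomputable def lastVisit (m : ℕ) (w : List α) (q : σ) : Fin (m + 1) × Option α :=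
  open Classical in
  let l := Nat.findGreatest (fun i => M.eval (w.take i) = q) m
  (⟨l, Nat.lt_succ_of_le (Nat.findGreatest_le m)⟩, w[l]?)

theorem exists_lastVisit_eq {m t : ℕ} (ht : t ≤ m) {w : List α} {q : σ}
    (hq : M.eval (w.take t) = q) :
    ∃ l, t ≤ l ∧ l ≤ m ∧ M.eval (w.take l) = q ∧
      ((M.lastVisit m w q).1 : ℕ) = l ∧ (M.lastVisit m w q).2 = w[l]? := by
  classical
  exact ⟨Nat.findGreatest (fun i => M.eval (w.take i) = q) m,
    Nat.le_findGreatest ht hq, Nat.findGreatest_le m,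
    Nat.findGreatest_spec (P := fun i => M.eval (w.take i) = q) ht hq, by
      simp only [lastVisit], by simp only [lastVisit]⟩

/-- Every state on an accepting run of `M` carries at most one loop of each length. -/
def UniqueLoops : Prop :=
  ∀ u x y v : List α, M.evalFrom (M.eval u) x = M.eval u → M.evalFrom (M.eval u) y = M.eval u →
    M.evalFrom (M.eval u) v ∈ M.accept → x.length = y.length → x = y

variable {M}

theorem UniqueLoops.eq_of_lastVisit_eq (hM : M.UniqueLoops) {m : ℕ} {w w' : List α}
    (hw : w ∈ M.accepts) (hm : w.length = m) (hm' : w'.length = m)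
    (h : M.lastVisit m w = M.lastVisit m w') : w = w' := by
  have key : ∀ t ≤ m, w.take t = w'.take t := by
    intro t
    induction t with
    | zero => simp
    | succ t ih =>
      intro ht
      have htake := ih (by omega)
      obtain ⟨l, htl, hlm, hl, hl1, hl2⟩ :=
        M.exists_lastVisit_eq (t := t) (m := m) (by omega) (w := w) rfl
      obtain ⟨l', -, -, hl', hl1', hl2'⟩ :=
        M.exists_lastVisit_eq (t := t) (m := m) (by omega) (w := w')
          (congrArg M.eval htake.symm)
      obtain rfl : l = l' := by rw [← hl1, h, hl1']
      rcases htl.eq_or_lt with rfl | htl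
      · rw [List.take_add_one, List.take_add_one, htake, ← hl2, h, hl2']
      · have split (z : List α) : z.take l = z.take t ++ (z.take l).drop t := by
          conv_lhs => rw [← List.take_append_drop t (z.take l), List.take_take, min_eq_left htl.le]
        have hloop : (w.take l).drop t = (w'.take l).drop t := by
          apply hM (w.take t) _ _ (w.drop t)
          · rwa [split w, eval, evalFrom_of_append] at hl
          · rw [split w', eval, evalFrom_of_append, ← htake] at hl'
            exact hl'
          · rw [eval, ← evalFrom_of_append, List.take_append_drop]
            exact hw
          · simp [hm, hm']
        have hl_take : w.take l = w'.take l := by rw [split w, split w', htake, hloop]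
        have := congrArg (List.take (t + 1)) hl_take
        rwa [List.take_take, List.take_take, min_eq_left (by omega)] at this
  have := key m le_rfl
  rwa [List.take_of_length_le hm.le, List.take_of_length_le hm'.le] at this

theorem UniqueLoops.hasPolynomialGrowth [Fintype α] [Fintype σ] (hM : M.UniqueLoops) :
    M.accepts.HasPolynomialGrowth := by
  classical
  refine ⟨((Polynomial.X + 1) * Polynomial.C (Fintype.card α + 1)) ^ Fintype.card σ,
    fun m => ?_⟩
  have hcard : (Set.univ : Set (σ → Fin (m + 1) × Option α)).ncard =
      ((m + 1) * (Fintype.card α + 1)) ^ Fintype.card σ := by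
    simp [Set.ncard_univ, Nat.card_eq_fintype_card]
  have hle : M.accepts.growthCount m ≤ (Set.univ : Set (σ → Fin (m + 1) × Option α)).ncard :=
    Set.ncard_le_ncard_of_injOn (M.lastVisit m) (fun _ _ => Set.mem_univ _)
      (fun _ hw _ hw' h => hM.eq_of_lastVisit_eq hw.1 hw.2 hw'.2 h)
  simpa [hcard] using hle

theorem evalFrom_flatten_of_loops {q : σ} {l : List (List α)}
    (hl : ∀ x ∈ l, M.evalFrom q x = q) : M.evalFrom q l.flatten = q := by
  induction l with
  | nil => rfl
  | cons x l ih =>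
    rw [List.flatten_cons, evalFrom_of_append, hl x (by simp)]
    exact ih fun y hy => hl y (by simp [hy])

theorem two_pow_le_growthCount [Finite α] {u x y v : List α}
    (hx : M.evalFrom (M.eval u) x = M.eval u) (hy : M.evalFrom (M.eval u) y = M.eval u)
    (hv : M.evalFrom (M.eval u) v ∈ M.accept) (hlen : x.length = y.length) (hne : x ≠ y) (n : ℕ) :
    2 ^ n ≤ M.accepts.growthCount (u.length + n * x.length + v.length) := by
  let g (b : Fin n → Bool) : List (List α) := List.ofFn fun i => if b i then x else y
  have hg (b : Fin n → Bool) : (g b).map List.length = List.replicate n x.length := by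
    rw [List.map_ofFn, ← List.ofFn_const]
    congr 1
    funext i
    by_cases hb : b i <;> simp [hb, hlen]
  have hloop (b : Fin n → Bool) : M.evalFrom (M.eval u) (g b).flatten = M.eval u := by
    refine evalFrom_flatten_of_loops fun z hz => ?_
    obtain ⟨i, rfl⟩ := (List.mem_ofFn' _ _).1 hz
    by_cases hb : b i <;> simp [hb, hx, hy]
  have hle : (Set.univ : Set (Fin n → Bool)).ncard ≤
      M.accepts.growthCount (u.length + n * x.length + v.length) := by
    refine Set.ncard_le_ncard_of_injOn (fun b => u ++ (g b).flatten ++ v) ?_ ?_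
      ((List.finite_length_eq α _).subset fun _ hw => hw.2)
    · refine fun b _ => ⟨?_, ?_⟩
      · change M.evalFrom M.start (u ++ (g b).flatten ++ v) ∈ M.accept
        rw [evalFrom_of_append, evalFrom_of_append]
        exact (hloop b).symm ▸ hv
      · simp [List.length_flatten, hg, add_assoc]
    · intro b _ b' _ h
      have hflat : (g b).flatten = (g b').flatten := by simpa using h
      have hgb : g b = g b' := List.eq_iff_flatten_eq.2 ⟨hflat, by rw [hg, hg]⟩
      funext i
      have hi := congrFun (List.ofFn_injective hgb) i
      cases hb : b i <;> cases hb' : b' i <;> simp_all [hne.symm]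
  simpa [Set.ncard_univ, Nat.card_eq_fintype_card] using hle

theorem hasExponentialGrowth_of_not_uniqueLoops [Finite α] (hM : ¬ M.UniqueLoops) :
    M.accepts.HasExponentialGrowth := by
  simp only [UniqueLoops, not_forall] at hM
  obtain ⟨u, x, y, v, hx, hy, hv, hlen, hne⟩ := hM
  have hpos : 0 < x.length := by
    refine Nat.pos_of_ne_zero fun h => hne ?_
    rw [List.length_eq_zero_iff.1 h, List.length_eq_zero_iff.1 (hlen.symm.trans h)]
  set d := u.length + x.length + v.length with hd
  have hd0 : d ≠ 0 := by omega
  have hr : (1 : ℝ) < 2 ^ (d : ℝ)⁻¹ := Real.one_lt_rpow one_lt_two (by positivity)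
  refine ⟨2 ^ (d : ℝ)⁻¹, hr, ?_⟩
  refine Set.infinite_of_injective_forall_mem
    (f := fun n : ℕ => u.length + (n + 1) * x.length + v.length) ?_ fun n => ?_
  · intro a b h
    have : (a + 1) * x.length = (b + 1) * x.length := by simp only at h; omega
    simpa using Nat.eq_of_mul_eq_mul_right hpos this
  · calc ((2 : ℝ) ^ (d : ℝ)⁻¹) ^ (u.length + (n + 1) * x.length + v.length)
        ≤ ((2 : ℝ) ^ (d : ℝ)⁻¹) ^ (d * (n + 1)) :=
          pow_le_pow_right₀ hr.le (by rw [hd]; nlinarith [Nat.zero_le (n * (u.length + v.length))])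
      _ = 2 ^ (n + 1) := by rw [pow_mul, Real.rpow_inv_natCast_pow zero_le_two hd0]
      _ ≤ _ := by exact_mod_cast two_pow_le_growthCount hx hy hv hlen hne (n + 1)

end DFA

/-- Every regular language over a finite alphabet has either polynomial growth or
exponential growth; no intermediate growth is possible. -/
theorem regular_polynomialGrowth_or_exponentialGrowth {α : Type} [Fintype α]
    (L : Language α) (hL : L.IsRegular) :
    L.HasPolynomialGrowth ∨ L.HasExponentialGrowth := by
  obtain ⟨σ, _, M, rfl⟩ := hL
  by_cases hM : M.UniqueLoops
  · exact .inl hM.hasPolynomialGrowth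
  · exact .inr (DFA.hasExponentialGrowth_of_not_uniqueLoops hM)
end
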